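/- arXiv:1605.09003 — 2 statements merged into one kernel-verified Lean document; each statement's English description precedes it below -/
import Mathlib

section
/- Let 1 ≤ a < 𝚒 ≤ r be integers and set M = span{e_{a+1}, …, e_{2r−a}}. Then (i) the ω-orthogonal complement of F^a in ℂ^{2r} equals F^{2r−a}; and (ii) the assignments E ↦ E ∩ M and E′ ↦ F^a + E′ are mutually inverse bijections between the set {E ⊆ ℂ^{2r} : dim E = 𝚒, E is ω-isotropic, and F^a ⊆ E} and the set {E′ ⊆ M : dim E′ = 𝚒 − a and E′ is ω-isotropic}. (This realizes the Schubert variety X_{a,2r−a} of the symplectic Grassmannian SG(𝚒, ℂ^{2r}) as the symplectic Grassmannian SG(𝚒 − a, ℂ^{2(r−a)}).) -/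
/-!
Symplectic Grassmannian SG(𝚒, ℂ^{2r}) setup (0-based indexing: the paper's
`e_k` is `e (2*r) ⟨k-1, _⟩`, and the 1-based condition `i + j = 2r + 1` becomes
`j = i.rev` on 0-based indices; the 1-based condition `i < j` becomes
`(i : ℕ) < r`).
-/

noncomputable section

/-- The standard basis vector `e_{i+1}` of `ℂ^{2r}`. -/
def e (m : ℕ) (i : Fin m) : Fin m → ℂ := Pi.single i 1

/-- The nondegenerate alternating bilinear form `ω` with `ω(e_i, e_j) = 1` if
`i < j`, `i + j = 2r + 1`, `ω(e_i, e_j) = −1` if `i > j`, `i + j = 2r + 1`,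
and `ω(e_i, e_j) = 0` otherwise (1-based indices). -/
def om (r : ℕ) (x y : Fin (2 * r) → ℂ) : ℂ :=
  ∑ i : Fin (2 * r), (if (i : ℕ) < r then (1 : ℂ) else -1) * x i * y i.rev

/-- `F r p` is the span `F^p` of the first `p` standard basis vectors. -/
def F (r p : ℕ) : Submodule ℂ (Fin (2 * r) → ℂ) :=
  Submodule.span ℂ {v | ∃ i : Fin (2 * r), (i : ℕ) < p ∧ v = e (2 * r) i}

/-- A subspace is `ω`-isotropic if `ω` vanishes identically on it. -/
def IsIsotropic (r : ℕ) (E : Submodule ℂ (Fin (2 * r) → ℂ)) : Prop :=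
  ∀ x ∈ E, ∀ y ∈ E, om r x y = 0

theorem mem_span_e_iff (m : ℕ) (p : Fin m → Prop) (x : Fin m → ℂ) :
    x ∈ Submodule.span ℂ {v | ∃ j : Fin m, p j ∧ v = e m j} ↔ ∀ j, ¬ p j → x j = 0 := by
  constructor
  · intro hx j hj
    induction hx using Submodule.span_induction with
    | mem v hv =>
      obtain ⟨k, hk, rfl⟩ := hv
      have hne : j ≠ k := by rintro rfl; exact hj hk
      simp [e, hne]
    | zero => rfl
    | add u v _ _ hu hv => simp [hu, hv]
    | smul c u _ hu => simp [hu]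
  · intro h
    rw [pi_eq_sum_univ' x]
    refine Submodule.sum_mem _ fun j _ => ?_
    by_cases hj : p j
    · refine Submodule.smul_mem _ _ (Submodule.subset_span ⟨j, hj, ?_⟩)
      ext k
      simp [e, Pi.single_apply, eq_comm]
    · simp [h j hj]

theorem mem_F_iff (r p : ℕ) (x : Fin (2 * r) → ℂ) :
    x ∈ F r p ↔ ∀ j : Fin (2 * r), p ≤ (j : ℕ) → x j = 0 := by
  rw [F, mem_span_e_iff]
  simp only [not_lt]

theorem finrank_F (r p : ℕ) (hp : p ≤ 2 * r) : Module.finrank ℂ (F r p) = p := by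
  have hli : LinearIndependent ℂ fun k : Fin p => e (2 * r) (Fin.castLE hp k) := by
    have h := (Pi.basisFun ℂ (Fin (2 * r))).linearIndependent.comp (Fin.castLE hp)
      (Fin.castLE_injective hp)
    convert h using 2
    simp [e]
  have hF : F r p = Submodule.span ℂ (Set.range fun k : Fin p => e (2 * r) (Fin.castLE hp k)) := by
    rw [F]
    congr 1
    ext v
    constructor
    · rintro ⟨k, hk, rfl⟩
      exact ⟨⟨k, hk⟩, rfl⟩
    · rintro ⟨k, rfl⟩
      exact ⟨Fin.castLE hp k, k.2, rfl⟩
  rw [hF, finrank_span_eq_card hli, Fintype.card_fin]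

theorem om_add_left (r : ℕ) (x x' y : Fin (2 * r) → ℂ) :
    om r (x + x') y = om r x y + om r x' y := by
  simp only [om, ← Finset.sum_add_distrib, Pi.add_apply]
  exact Finset.sum_congr rfl fun _ _ => by ring

theorem om_add_right (r : ℕ) (x y y' : Fin (2 * r) → ℂ) :
    om r x (y + y') = om r x y + om r x y' := by
  simp only [om, ← Finset.sum_add_distrib, Pi.add_apply]
  exact Finset.sum_congr rfl fun _ _ => by ring

theorem om_eq_zero_of_mem_F_left (r a : ℕ) (x y : Fin (2 * r) → ℂ)
    (hx : x ∈ F r a) (hy : y ∈ F r (2 * r - a)) : om r x y = 0 := by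
  rw [mem_F_iff] at hx hy
  refine Finset.sum_eq_zero fun j _ => ?_
  rcases le_or_gt a (j : ℕ) with h | h
  · simp [hx j h]
  · simp [hy j.rev (by rw [Fin.val_rev]; omega)]

theorem om_eq_zero_of_mem_F_right (r a : ℕ) (x y : Fin (2 * r) → ℂ)
    (hx : x ∈ F r (2 * r - a)) (hy : y ∈ F r a) : om r x y = 0 := by
  rw [mem_F_iff] at hx hy
  refine Finset.sum_eq_zero fun j _ => ?_
  rcases le_or_gt (2 * r - a) (j : ℕ) with h | h
  · simp [hx j h]
  · simp [hy j.rev (by rw [Fin.val_rev]; omega)]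

theorem om_e_rev_eq_zero_iff (r : ℕ) (x : Fin (2 * r) → ℂ) (j : Fin (2 * r)) :
    om r x (e (2 * r) j.rev) = 0 ↔ x j = 0 := by
  rw [om, Finset.sum_eq_single j]
  · split_ifs <;> simp [e]
  · intro k _ hk
    simp [e, hk]
  · simp

theorem orthogonal_F (r a : ℕ) (x : Fin (2 * r) → ℂ) :
    (∀ y ∈ F r a, om r x y = 0) ↔ x ∈ F r (2 * r - a) := by
  refine ⟨fun h => ?_, fun hx y hy => om_eq_zero_of_mem_F_right r a x y hx hy⟩
  rw [mem_F_iff]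
  intro j hj
  rw [← om_e_rev_eq_zero_iff]
  exact h _ (Submodule.subset_span ⟨j.rev, by rw [Fin.val_rev]; omega, rfl⟩)

/-- For `1 ≤ a < 𝚒 ≤ r` and `M = span{e_{a+1}, …, e_{2r−a}}`:
(i) the `ω`-orthogonal complement of `F^a` in `ℂ^{2r}` equals `F^{2r−a}`; and
(ii) `E ↦ E ∩ M` and `E′ ↦ F^a + E′` are mutually inverse bijections between
`{E : dim E = 𝚒, E ω-isotropic, F^a ⊆ E}` and
`{E′ ⊆ M : dim E′ = 𝚒 − a, E′ ω-isotropic}`.  (This realizes the Schubert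
variety `X_{a,2r−a}` of `SG(𝚒, ℂ^{2r})` as `SG(𝚒 − a, ℂ^{2(r−a)})`.) -/
theorem stmt9 (r a i : ℕ) (ha : 1 ≤ a) (hai : a < i) (hir : i ≤ r)
    (M : Submodule ℂ (Fin (2 * r) → ℂ))
    (hM : M = Submodule.span ℂ
      {v | ∃ j : Fin (2 * r), a ≤ (j : ℕ) ∧ (j : ℕ) < 2 * r - a ∧ v = e (2 * r) j})
    (S1 S2 : Set (Submodule ℂ (Fin (2 * r) → ℂ)))
    (hS1 : S1 = {E : Submodule ℂ (Fin (2 * r) → ℂ) |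
      Module.finrank ℂ E = i ∧ IsIsotropic r E ∧ F r a ≤ E})
    (hS2 : S2 = {E' : Submodule ℂ (Fin (2 * r) → ℂ) |
      E' ≤ M ∧ Module.finrank ℂ E' = i - a ∧ IsIsotropic r E'}) :
    ({x : Fin (2 * r) → ℂ | ∀ y ∈ F r a, om r x y = 0} = ↑(F r (2 * r - a))) ∧
    (∀ E ∈ S1, E ⊓ M ∈ S2) ∧
    (∀ E' ∈ S2, F r a ⊔ E' ∈ S1) ∧
    (∀ E ∈ S1, F r a ⊔ (E ⊓ M) = E) ∧
    (∀ E' ∈ S2, (F r a ⊔ E') ⊓ M = E') := by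
  have memM (x : Fin (2 * r) → ℂ) : x ∈ M ↔
      ∀ j : Fin (2 * r), ((j : ℕ) < a ∨ 2 * r - a ≤ (j : ℕ)) → x j = 0 := by
    have h := mem_span_e_iff (2 * r) (fun j => a ≤ (j : ℕ) ∧ (j : ℕ) < 2 * r - a) x
    simp only [and_assoc] at h
    rw [hM, h]
    refine forall_congr' fun j => ?_
    rw [not_and_or, not_le, not_lt]
  have hMF : M ≤ F r (2 * r - a) := fun x hx =>
    (mem_F_iff _ _ _).2 fun j hj => (memM x).1 hx j (Or.inr hj)
  have hdisj : F r a ⊓ M = ⊥ := by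
    rw [eq_bot_iff]
    rintro x ⟨hxF, hxM⟩
    rw [Submodule.mem_bot]
    ext j
    rcases lt_or_ge (j : ℕ) a with h | h
    · exact (memM x).1 hxM j (Or.inl h)
    · exact (mem_F_iff _ _ _).1 hxF j h
  have hfr (E' : Submodule ℂ (Fin (2 * r) → ℂ)) (hE' : E' ≤ M) :
      Module.finrank ℂ ↥(F r a ⊔ E') = a + Module.finrank ℂ E' := by
    have h := Submodule.finrank_sup_add_finrank_inf_eq (F r a) E'
    have hbot : F r a ⊓ E' = ⊥ := eq_bot_iff.2 (hdisj ▸ inf_le_inf_left _ hE')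
    rwa [hbot, finrank_bot, add_zero, finrank_F r a (by omega)] at h
  have hsup : ∀ E ∈ S1, F r a ⊔ (E ⊓ M) = E := by
    intro E hE
    rw [hS1] at hE
    obtain ⟨-, hiso, hFE⟩ := hE
    refine le_antisymm (sup_le hFE inf_le_left) fun x hx => ?_
    have hx' := (mem_F_iff _ _ _).1
      ((orthogonal_F r a x).1 fun y hy => hiso x hx y (hFE hy))
    let u : Fin (2 * r) → ℂ := fun j => if (j : ℕ) < a then x j else 0
    have hu : u ∈ F r a := (mem_F_iff _ _ _).2 fun j hj => if_neg (not_lt.2 hj)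
    refine Submodule.mem_sup.2 ⟨u, hu, x - u, ⟨E.sub_mem hx (hFE hu), ?_⟩, by abel⟩
    refine (memM _).2 fun j hj => ?_
    by_cases h : (j : ℕ) < a
    · simp [u, h]
    · simp [u, h, hx' j (hj.resolve_left h)]
  refine ⟨Set.ext (orthogonal_F r a), fun E hE => ?_, fun E' hE' => ?_, hsup, fun E' hE' => ?_⟩
  · have hs := hsup E hE
    rw [hS1] at hE
    obtain ⟨hdim, hiso, -⟩ := hE
    rw [hS2]
    refine ⟨inf_le_right, ?_, fun x hx y hy => hiso x hx.1 y hy.1⟩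
    have h := hfr (E ⊓ M) inf_le_right
    rw [hs, hdim] at h
    omega
  · rw [hS2] at hE'
    obtain ⟨hle, hdim, hiso⟩ := hE'
    rw [hS1]
    refine ⟨by rw [hfr E' hle, hdim]; omega, fun x hx y hy => ?_, le_sup_left⟩
    obtain ⟨x₁, hx₁, x₂, hx₂, rfl⟩ := Submodule.mem_sup.1 hx
    have hyF : F r a ⊔ E' ≤ F r (2 * r - a) := by
      refine sup_le (fun z hz => ?_) (hle.trans hMF)
      rw [mem_F_iff] at hz ⊢
      exact fun j hj => hz j (by omega)
    obtain ⟨y₁, hy₁, y₂, hy₂, rfl⟩ := Submodule.mem_sup.1 hy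
    rw [om_add_left, om_eq_zero_of_mem_F_left r a x₁ _ hx₁ (hyF hy), om_add_right,
      om_eq_zero_of_mem_F_right r a x₂ y₁ (hMF (hle hx₂)) hy₁, hiso x₂ hx₂ y₂ hy₂]
    simp
  · rw [hS2] at hE'
    rw [sup_comm, sup_inf_assoc_of_le _ hE'.1, hdisj, sup_bot_eq]

end
end

section
/- Let 1 ≤ a < 𝚒 < r be integers. Then the set {E ⊆ ℂ^{2r} : dim E = 𝚒, E is ω-isotropic, and F^a ⊆ E ⊆ F^{2r−a}} (the Schubert variety X_{a,2r−a} of the symplectic Grassmannian SG(𝚒, ℂ^{2r})) is NOT horizontal: there exist differentiable curves v_1, …, v_𝚒 : ℝ → ℂ^{2r} such that for every t ∈ ℝ the vectors v_1(t), …, v_𝚒(t) are linearly independent and their span E(t) is an ω-isotropic 𝚒-dimensional subspace with F^a ⊆ E(t) ⊆ F^{2r−a}, and yet ω(v_k(0), v_l′(0)) ≠ 0 for some k, l ∈ {1, …, 𝚒}. -/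
/-!
Symplectic Grassmannian SG(𝚒, ℂ^{2r}) setup (0-based indexing: the paper's
`e_k` is `e (2*r) ⟨k-1, _⟩`, and the 1-based condition `i + j = 2r + 1` becomes
`j = i.rev` on 0-based indices; the 1-based condition `i < j` becomes
`(i : ℕ) < r`).
-/

noncomputable section

/-- A set `𝒳` of (`n`-dimensional) subspaces of `ℂ^{2r}` is horizontal if for
all differentiable curves `v_1, …, v_n` which stay linearly independent with
span belonging to `𝒳`, each `v_k` pairs to zero under `ω` with each derivative
`v_l′` (the condition `dE ⊆ E^⊥`). -/
def HorizontalFam (r n : ℕ) (𝒳 : Set (Submodule ℂ (Fin (2 * r) → ℂ))) : Prop :=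
  ∀ v : Fin n → ℝ → (Fin (2 * r) → ℂ),
    (∀ k, Differentiable ℝ (v k)) →
    (∀ t : ℝ, LinearIndependent ℂ (fun k => v k t)) →
    (∀ t : ℝ, Submodule.span ℂ (Set.range fun k => v k t) ∈ 𝒳) →
    ∀ k l : Fin n, ∀ t : ℝ, om r (v k t) (deriv (v l) t) = 0

theorem om_e_left (r : ℕ) (j : Fin (2 * r)) (y : Fin (2 * r) → ℂ) :
    om r (e (2 * r) j) y = (if (j : ℕ) < r then (1 : ℂ) else -1) * y j.rev := by
  unfold om e
  rw [Finset.sum_eq_single j]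
  · simp
  · intro b _ hb
    simp [hb]
  · simp

theorem om_smul_left (r : ℕ) (c : ℂ) (x y : Fin (2 * r) → ℂ) :
    om r (c • x) y = c * om r x y := by
  simp only [om, Pi.smul_apply, smul_eq_mul, Finset.mul_sum]
  exact Finset.sum_congr rfl fun _ _ => by ring

theorem om_smul_right (r : ℕ) (c : ℂ) (x y : Fin (2 * r) → ℂ) :
    om r x (c • y) = c * om r x y := by
  simp only [om, Pi.smul_apply, smul_eq_mul, Finset.mul_sum]
  exact Finset.sum_congr rfl fun _ _ => by ring

theorem isIsotropic_span (r : ℕ) (s : Set (Fin (2 * r) → ℂ))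
    (hs : ∀ x ∈ s, ∀ y ∈ s, om r x y = 0) : IsIsotropic r (Submodule.span ℂ s) := by
  intro x hx y hy
  induction hx, hy using Submodule.span_induction₂ with
  | mem_mem x y hx hy => exact hs x hx y hy
  | zero_left y hy => simp [om]
  | zero_right x hx => simp [om]
  | add_left x y z _ _ _ h₁ h₂ => rw [om_add_left, h₁, h₂, add_zero]
  | add_right x y z _ _ _ h₁ h₂ => rw [om_add_right, h₁, h₂, add_zero]
  | smul_left c x y _ _ h => rw [om_smul_left, h, mul_zero]
  | smul_right c x y _ _ h => rw [om_smul_right, h, mul_zero]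

/-- The vector `e_k + c e_{k*}`, where `e_{k*}` is the basis vector dual to `e_k` under `ω`. -/
def tiltedVec (m : ℕ) (k : Fin m) (c : ℂ) : Fin m → ℂ := e m k + c • e m k.rev

theorem tiltedVec_apply_of_lt {r : ℕ} {j k : Fin (2 * r)} (hj : (j : ℕ) < r) (hk : (k : ℕ) < r)
    (c : ℂ) : tiltedVec (2 * r) k c j = if j = k then 1 else 0 := by
  have h : j ≠ k.rev := by
    intro h
    have := congrArg Fin.val h
    simp only [Fin.val_rev] at this
    omega
  simp [tiltedVec, e, Pi.single_apply, h]

theorem tiltedVec_apply_rev {r : ℕ} {j k : Fin (2 * r)} (hj : (j : ℕ) < r) (hk : (k : ℕ) < r)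
    (c : ℂ) : tiltedVec (2 * r) k c j.rev = if j = k then c else 0 := by
  have h : j.rev ≠ k := by
    intro h
    have := congrArg Fin.val h
    simp only [Fin.val_rev] at this
    omega
  simp [tiltedVec, e, Pi.single_apply, h]

theorem om_tiltedVec {r : ℕ} {j k : Fin (2 * r)} (hj : (j : ℕ) < r) (hk : (k : ℕ) < r)
    (c d : ℂ) :
    om r (tiltedVec (2 * r) j c) (tiltedVec (2 * r) k d) = if j = k then d - c else 0 := by
  have h : ¬ ((j.rev : Fin (2 * r)) : ℕ) < r := by
    simp only [Fin.val_rev]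
    omega
  rw [tiltedVec, om_add_left, om_smul_left, om_e_left, om_e_left, Fin.rev_rev,
    tiltedVec_apply_rev hj hk, tiltedVec_apply_of_lt hj hk, if_pos hj, if_neg h]
  split_ifs <;> ring

theorem linearIndependent_tiltedVec {r i : ℕ} (f : Fin i → Fin (2 * r))
    (hf : Function.Injective f) (hr : ∀ k, (f k : ℕ) < r) (c : Fin i → ℂ) :
    LinearIndependent ℂ fun k => tiltedVec (2 * r) (f k) (c k) := by
  rw [Fintype.linearIndependent_iff]
  intro g hg k
  have h := congrFun hg (f k)
  simpa [Finset.sum_apply, tiltedVec_apply_of_lt (hr _) (hr _), hf.eq_iff] using h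

theorem hasDerivAt_tiltedVec (m : ℕ) (k : Fin m) (c : ℂ) (t : ℝ) :
    HasDerivAt (fun t : ℝ => tiltedVec m k ((t : ℂ) * c)) (c • e m k.rev) t := by
  have h : HasDerivAt (fun t : ℝ => (t : ℂ) * c) c t := by
    simpa using (Complex.ofRealCLM.hasDerivAt (x := t)).mul_const c
  exact (h.smul_const (e m k.rev)).const_add (e m k)

/-- For `1 ≤ a < 𝚒 < r`, the Schubert variety
`X_{a,2r−a} = {E : dim E = 𝚒, E ω-isotropic, F^a ⊆ E ⊆ F^{2r−a}}` of
`SG(𝚒, ℂ^{2r})` is NOT horizontal: there are differentiable curves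
`v_1, …, v_𝚒` which stay linearly independent, whose span is an `ω`-isotropic
`𝚒`-dimensional subspace pinched between `F^a` and `F^{2r−a}`, and yet
`ω(v_k(0), v_l′(0)) ≠ 0` for some `k, l`. -/
theorem stmt11 (r a i : ℕ) (ha : 1 ≤ a) (hai : a < i) (hir : i < r)
    (𝒳 : Set (Submodule ℂ (Fin (2 * r) → ℂ)))
    (h𝒳 : 𝒳 = {E : Submodule ℂ (Fin (2 * r) → ℂ) |
      Module.finrank ℂ E = i ∧ IsIsotropic r E ∧ F r a ≤ E ∧ E ≤ F r (2 * r - a)}) :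
    ¬ HorizontalFam r i 𝒳 ∧
    ∃ v : Fin i → ℝ → (Fin (2 * r) → ℂ),
      (∀ k, Differentiable ℝ (v k)) ∧
      (∀ t : ℝ, LinearIndependent ℂ (fun k => v k t)) ∧
      (∀ t : ℝ, Submodule.span ℂ (Set.range fun k => v k t) ∈ 𝒳) ∧
      ∃ k l : Fin i, om r (v k 0) (deriv (v l) 0) ≠ 0 := by
  suffices h : ∃ v : Fin i → ℝ → (Fin (2 * r) → ℂ),
      (∀ k, Differentiable ℝ (v k)) ∧
      (∀ t : ℝ, LinearIndependent ℂ (fun k => v k t)) ∧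
      (∀ t : ℝ, Submodule.span ℂ (Set.range fun k => v k t) ∈ 𝒳) ∧
      ∃ k l : Fin i, om r (v k 0) (deriv (v l) 0) ≠ 0 by
    refine ⟨fun hor => ?_, h⟩
    obtain ⟨v, hd, hli, hmem, k, l, hne⟩ := h
    exact hne (hor v hd hli hmem k l 0)
  subst h𝒳
  let f : Fin i → Fin (2 * r) := Fin.castLE (by omega)
  have hf : Function.Injective f := Fin.castLE_injective _
  have hr : ∀ k, (f k : ℕ) < r := fun k => k.2.trans hir
  let c : Fin i → ℂ := fun k => if (k : ℕ) + 1 = i then 1 else 0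
  have hli (t : ℝ) := linearIndependent_tiltedVec f hf hr fun k => (t : ℂ) * c k
  refine ⟨fun k t => tiltedVec (2 * r) (f k) ((t : ℂ) * c k),
    fun k t => (hasDerivAt_tiltedVec _ _ _ t).differentiableAt, hli,
    fun t => ⟨?_, ?_, ?_, ?_⟩, ?_⟩
  · rw [finrank_span_eq_card (hli t), Fintype.card_fin]
  · apply isIsotropic_span
    rintro _ ⟨k, rfl⟩ _ ⟨l, rfl⟩
    rw [om_tiltedVec (hr k) (hr l)]
    split_ifs with h
    · rw [hf h, sub_self]
    · rfl
  · refine Submodule.span_le.2 ?_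
    rintro _ ⟨j, hj, rfl⟩
    refine Submodule.subset_span ⟨⟨j, by omega⟩, ?_⟩
    have hc : c ⟨j, by omega⟩ = 0 := if_neg (by simp only; omega)
    simp [hc, tiltedVec, f]
  · refine Submodule.span_le.2 ?_
    rintro _ ⟨k, rfl⟩
    refine Submodule.add_mem _ (Submodule.subset_span ⟨f k, ?_, rfl⟩) ?_
    · have := hr k
      omega
    · by_cases hk : (k : ℕ) + 1 = i
      · refine Submodule.smul_mem _ _ (Submodule.subset_span ⟨(f k).rev, ?_, rfl⟩)
        simp only [f, Fin.val_rev, Fin.val_castLE]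
        omega
      · simp [c, hk]
  · let l : Fin i := ⟨i - 1, by omega⟩
    have hc : c l = 1 := if_pos (by simp only [l]; omega)
    refine ⟨l, l, ?_⟩
    rw [(hasDerivAt_tiltedVec _ _ _ 0).deriv]
    simp only [hc, tiltedVec, Complex.ofReal_zero, zero_mul, zero_smul, add_zero, one_smul, om_e_left,
      if_pos (hr l)]
    simp [e]

end
end
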